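/- Let Δ be a simplicial complex on {1,…,r} with facets F_1,…,F_t, and suppose there exist n ≥ 1, i ≥ 0 and α ∈ ℕ^r with H_m^i(R/I_Δ^{(n)})_α ≠ 0 and (after renumbering) F(Δ_α(I_Δ^{(n)})) = {F_1,…,F_s}, where 1 ≤ s ≤ t. Then the polyhedron C_1 ⊆ ℝ^r defined by ∑_{i∉F_j} x_i ≤ 1 for j = 1,…,s, ∑_{i∉F_j} x_i ≥ 1 for j = s+1,…,t, and x_1 ≥ 0,…,x_r ≥ 0, is a polytope (i.e. bounded) of dimension r. -/

import Mathlib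

open MvPolynomial Finset Filter

noncomputable section

/-- A family of potential faces (subsets of the vertex set `ι`). -/
abbrev FaceSet (ι : Type*) := Set (Finset ι)

/-- A face set is a simplicial complex if it is closed under taking subsets. -/
def IsSimplicialComplex {ι : Type*} (Δ : FaceSet ι) : Prop :=
  ∀ σ ∈ Δ, ∀ τ : Finset ι, τ ⊆ σ → τ ∈ Δ

/-- The facets (maximal faces) of a face set. -/
def facets {ι : Type*} (Δ : FaceSet ι) : FaceSet ι :=
  {σ | σ ∈ Δ ∧ ∀ τ ∈ Δ, σ ⊆ τ → σ = τ}

/-- The Stanley–Reisner ideal of a simplicial complex: it is generated by the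
square-free monomials corresponding to non-faces. -/
def srIdeal (K : Type*) [Field K] {ι : Type*} (Δ : FaceSet ι) :
    Ideal (MvPolynomial ι K) :=
  Ideal.span {p | ∃ τ : Finset ι, τ ∉ Δ ∧ p = ∏ i ∈ τ, X i}

/-- The `n`-th symbolic power `I^{(n)} = ⋂_{p ∈ Min(I)} (Iⁿ R_p ∩ R)`. -/
def symbolicPower {R : Type*} [CommRing R] (I : Ideal R) (n : ℕ) : Ideal R :=
  ⨅ (p : Ideal R) (hp : p ∈ I.minimalPrimes),
    letI : p.IsPrime := hp.1.1
    (Ideal.map (algebraMap R (Localization.AtPrime p)) (I ^ n)).comap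
      (algebraMap R (Localization.AtPrime p))

/-- The simplicial boundary operator on the space of chains (finitely supported
`K`-valued functions on finite subsets of `ι`), using the orientation coming
from the linear order of `ι`; a set of cardinality `d` is viewed as a
`(d-1)`-dimensional simplex, the empty set accounting for the augmentation. -/
def bdry (K : Type*) [Field K] {ι : Type*} [LinearOrder ι] :
    (Finset ι →₀ K) →ₗ[K] (Finset ι →₀ K) :=
  Finsupp.lsum K fun σ => LinearMap.toSpanSingleton K _
    (∑ v ∈ σ, ((-1 : K) ^ (σ.filter fun w => w < v).card) • Finsupp.single (σ.erase v) (1 : K))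

/-- The subspace of chains supported on the faces of `Δ` of cardinality `d`. -/
def cardFaces (K : Type*) [Field K] {ι : Type*} (Δ : FaceSet ι) (d : ℕ) :
    Submodule K (Finset ι →₀ K) :=
  Submodule.span K {f | ∃ σ ∈ Δ, σ.card = d ∧ f = Finsupp.single σ (1 : K)}

/-- `H̃ⱼ(Δ; K) ≠ 0`: there is a cycle of cardinality-degree `j + 1` which is not
a boundary of a chain of `Δ`. -/
def HasNontrivialReducedHomology (K : Type*) [Field K] {ι : Type*} [LinearOrder ι]
    (Δ : FaceSet ι) (j : ℤ) : Prop :=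
  ∃ d : ℕ, (d : ℤ) = j + 1 ∧
    ∃ z ∈ cardFaces K Δ d, bdry K z = 0 ∧ z ∉ ⇑(bdry K) '' ↑(cardFaces K Δ (d + 1))

/-- `G_α = {i : α_i < 0}`. -/
def negSupport {ι : Type*} [Fintype ι] (α : ι → ℤ) : Finset ι :=
  Finset.univ.filter fun i => α i < 0

/-- The degree complex `Δ_α(I) = {F ⊆ [r] \ G_α : x^α ∉ I·R_F}` of Takayama, where
`x^α ∈ I·R_F` is expressed by saturation: `x^{α⁺}·(∏_{i ∈ F ∪ G_α} x_i)^m ∈ I` for some `m`. -/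
def degreeComplex (K : Type*) [Field K] {ι : Type*} [Fintype ι] [LinearOrder ι]
    (I : Ideal (MvPolynomial ι K)) (α : ι → ℤ) : FaceSet ι :=
  {F | (∀ i ∈ F, 0 ≤ α i) ∧
    ¬∃ m : ℕ,
      monomial (Finsupp.equivFunOnFinite.symm fun i => (α i).toNat) (1 : K) *
        (∏ i ∈ F ∪ negSupport α, X i) ^ m ∈ I}

/-- Nonvanishing of the graded piece `H_𝔪^i(R/I)_α` of local cohomology of a monomial
quotient, expressed via Takayama's formula
`dim_K H_𝔪^i(R/I)_α = dim_K H̃_{i-|G_α|-1}(Δ_α(I); K)`. -/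
def lcNonzero (K : Type*) [Field K] {ι : Type*} [Fintype ι] [LinearOrder ι]
    (I : Ideal (MvPolynomial ι K)) (i : ℕ) (α : ι → ℤ) : Prop :=
  HasNontrivialReducedHomology K (degreeComplex K I α) ((i : ℤ) - (negSupport α).card - 1)

/-- The `a_i`-invariant `a_i(R/I) = max{t : H_𝔪^i(R/I)_t ≠ 0}` of a monomial quotient
(`H_𝔪^i(R/I)_t = ⊕_{|α| = t} H_𝔪^i(R/I)_α`). -/
def aInv (K : Type*) [Field K] {ι : Type*} [Fintype ι] [LinearOrder ι]
    (I : Ideal (MvPolynomial ι K)) (i : ℕ) : ℤ :=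
  sSup {z : ℤ | ∃ α : ι → ℤ, lcNonzero K I i α ∧ z = ∑ j, α j}

/-- The Castelnuovo–Mumford regularity `reg(R/I) = max_i (a_i(R/I) + i)` of a
monomial quotient. -/
def regQuot (K : Type*) [Field K] {ι : Type*} [Fintype ι] [LinearOrder ι]
    (I : Ideal (MvPolynomial ι K)) : ℤ :=
  sSup {z : ℤ | ∃ (i : ℕ) (α : ι → ℤ), lcNonzero K I i α ∧ z = (∑ j, α j) + i}

/-- The Castelnuovo–Mumford regularity of a (monomial) ideal: `reg(I) = reg(R/I) + 1`. -/
def reg (K : Type*) [Field K] {ι : Type*} [Fintype ι] [LinearOrder ι]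
    (I : Ideal (MvPolynomial ι K)) : ℤ :=
  regQuot K I + 1

/-- The depth `min{i : H_𝔪^i(R/I) ≠ 0}` of a monomial quotient. -/
def depthQuot (K : Type*) [Field K] {ι : Type*} [Fintype ι] [LinearOrder ι]
    (I : Ideal (MvPolynomial ι K)) : ℕ :=
  sInf {i : ℕ | ∃ α : ι → ℤ, lcNonzero K I i α}

/-- The projective dimension `pd(R/I) = r - depth(R/I)` (Auslander–Buchsbaum). -/
def pdQuot (K : Type*) [Field K] {ι : Type*} [Fintype ι] [LinearOrder ι]
    (I : Ideal (MvPolynomial ι K)) : ℤ :=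
  (Fintype.card ι : ℤ) - depthQuot K I

end
/-- The polyhedron in `ℝ^r` given by `∑_{i ∉ F_j} x_i ≤ m` for `j < s`,
`∑_{i ∉ F_j} x_i ≥ m` for `s ≤ j < t`, and `x ≥ 0`. -/
def polyC {r t : ℕ} (F : Fin t → Finset (Fin r)) (s : ℕ) (m : ℝ) : Set (Fin r → ℝ) :=
  {x | (∀ i, 0 ≤ x i) ∧ ∀ j : Fin t,
    ((j : ℕ) < s → ∑ i ∈ (F j)ᶜ, x i ≤ m) ∧ (s ≤ (j : ℕ) → m ≤ ∑ i ∈ (F j)ᶜ, x i)}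
section StanleyReisner

variable {K : Type*} [Field K] {ι : Type*}

theorem pow_le_symbolicPower {R : Type*} [CommRing R] (I : Ideal R) (n : ℕ) :
    I ^ n ≤ symbolicPower I n :=
  le_iInf fun _ => le_iInf fun _ => Ideal.le_comap_map

theorem mem_degreeComplex_natCast [Fintype ι] [LinearOrder ι] (I : Ideal (MvPolynomial ι K))
    (α : ι → ℕ) (F : Finset ι) :
    F ∈ degreeComplex K I (fun i => (α i : ℤ)) ↔
      ∀ m : ℕ, (∏ i, X i ^ α i) * (∏ i ∈ F, X i) ^ m ∉ I := by
  have hneg : negSupport (fun i => (α i : ℤ)) = ∅ := by simp [negSupport]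
  have hmon : monomial (Finsupp.equivFunOnFinite.symm fun i => α i) (1 : K)
      = ∏ i, X i ^ α i := by
    rw [monomial_eq, C_1, one_mul, Finsupp.prod_fintype _ _ (by simp)]
    rfl
  simp [degreeComplex, hneg, hmon]

theorem degreeComplex_natCast_isSimplicialComplex [Fintype ι] [LinearOrder ι]
    (I : Ideal (MvPolynomial ι K)) (α : ι → ℕ) :
    IsSimplicialComplex (degreeComplex K I (fun i => (α i : ℤ))) := by
  intro σ hσ τ hτ
  rw [mem_degreeComplex_natCast] at hσ ⊢
  intro m hm
  refine hσ m (I.mem_of_dvd ?_ hm)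
  exact mul_dvd_mul_left _ (pow_dvd_pow_of_dvd (Finset.prod_dvd_prod_of_subset _ _ _ hτ) m)

theorem prod_X_mem_srIdeal {Δ : FaceSet ι} {τ : Finset ι} (hτ : τ ∉ Δ) :
    ∏ i ∈ τ, (X i : MvPolynomial ι K) ∈ srIdeal K Δ :=
  Ideal.subset_span ⟨τ, hτ, rfl⟩

theorem degreeComplex_symbolicPower_subset [Fintype ι] [LinearOrder ι] (Δ : FaceSet ι) (n : ℕ)
    (α : ι → ℕ) :
    degreeComplex K (symbolicPower (srIdeal K Δ) n) (fun i => (α i : ℤ)) ⊆ Δ := by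
  intro σ hσ
  rw [mem_degreeComplex_natCast] at hσ
  by_contra h
  exact hσ n (Ideal.mul_mem_left _ _
    (pow_le_symbolicPower _ _ (Ideal.pow_mem_pow (prod_X_mem_srIdeal h) n)))

theorem X_mul_prod_X_mem_srIdeal [DecidableEq ι] {Δ : FaceSet ι} {F : Finset ι}
    (hF : F ∈ facets Δ) {i : ι} (hi : i ∉ F) :
    X i * ∏ j ∈ F, (X j : MvPolynomial ι K) ∈ srIdeal K Δ := by
  rw [← Finset.prod_insert hi]
  refine prod_X_mem_srIdeal fun h => hi ?_
  rw [hF.2 _ h (Finset.subset_insert _ _)]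
  exact Finset.mem_insert_self _ _

/-- A facet `F` of `Δ` lying in the degree complex of `I_Δ^{(n)}` at `α` satisfies
`∑_{i ∉ F} α_i < n`. -/
theorem sum_compl_lt_of_mem_degreeComplex [Fintype ι] [LinearOrder ι] {Δ : FaceSet ι}
    {F : Finset ι} (hF : F ∈ facets Δ) {n : ℕ} {α : ι → ℕ}
    (h : F ∈ degreeComplex K (symbolicPower (srIdeal K Δ) n) (fun i => (α i : ℤ))) :
    ∑ i ∈ Fᶜ, α i < n := by
  by_contra! hle
  rw [mem_degreeComplex_natCast] at h
  refine h (∑ i ∈ Fᶜ, α i) (pow_le_symbolicPower _ _ (Ideal.pow_le_pow_right hle ?_))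
  have hmem : ∏ i ∈ Fᶜ, (X i * ∏ j ∈ F, (X j : MvPolynomial ι K)) ^ α i ∈
      srIdeal K Δ ^ ∑ i ∈ Fᶜ, α i := by
    rw [← Finset.prod_pow_eq_pow_sum]
    exact Ideal.prod_mem_prod fun i hi =>
      Ideal.pow_mem_pow (X_mul_prod_X_mem_srIdeal hF (Finset.mem_compl.1 hi)) _
  simp only [mul_pow, Finset.prod_mul_distrib, Finset.prod_pow_eq_pow_sum] at hmem
  rw [← Finset.prod_mul_prod_compl F (fun i => (X i : MvPolynomial ι K) ^ α i), mul_assoc]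
  exact Ideal.mul_mem_left _ _ hmem

/-- The evaluation setting the variables outside `F` to zero. -/
noncomputable def restrictVars (K : Type*) [Field K] {ι : Type*} [DecidableEq ι] (F : Finset ι) :
    MvPolynomial ι K →ₐ[K] MvPolynomial ι K :=
  aeval fun i => if i ∈ F then X i else 0

/-- The substitution scaling each variable outside `F` by a new variable `T`. -/
noncomputable def scaleVars (K : Type*) [Field K] {ι : Type*} [DecidableEq ι] (F : Finset ι) :
    MvPolynomial ι K →ₐ[K] Polynomial (MvPolynomial ι K) :=
  aeval fun i => if i ∈ F then Polynomial.C (X i) else Polynomial.C (X i) * Polynomial.X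

theorem coeff_zero_scaleVars [DecidableEq ι] (F : Finset ι) (f : MvPolynomial ι K) :
    (scaleVars K F f).coeff 0 = restrictVars K F f := by
  have h : ((Polynomial.aeval (0 : MvPolynomial ι K)).restrictScalars K).comp (scaleVars K F)
      = restrictVars K F := by
    ext i : 1
    by_cases hi : i ∈ F <;> simp [scaleVars, restrictVars, hi]
  rw [← h, Polynomial.coeff_zero_eq_aeval_zero]
  rfl

theorem ker_restrictVars_le [DecidableEq ι] (F : Finset ι) {J : Ideal (MvPolynomial ι K)}
    (hJ : ∀ i ∉ F, X i ∈ J) : RingHom.ker (restrictVars K F) ≤ J := by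
  intro f hf
  have h : (Ideal.Quotient.mkₐ K J).comp (restrictVars K F) = Ideal.Quotient.mkₐ K J := by
    ext i : 1
    by_cases hi : i ∈ F
    · simp [restrictVars, hi]
    · simp [restrictVars, hi, (Ideal.Quotient.eq_zero_iff_mem.2 (hJ i hi))]
  have h' := DFunLike.congr_fun h f
  rw [AlgHom.comp_apply, (RingHom.mem_ker).1 hf, map_zero] at h'
  exact Ideal.Quotient.eq_zero_iff_mem.1 h'.symm

theorem exists_mem_not_mem_of_not_mem {Δ : FaceSet ι} (hΔ : IsSimplicialComplex Δ)
    {F τ : Finset ι} (hF : F ∈ Δ) (hτ : τ ∉ Δ) : ∃ i ∈ τ, i ∉ F :=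
  Finset.not_subset.1 fun h => hτ (hΔ F hF τ h)

theorem ker_restrictVars_mem_minimalPrimes [DecidableEq ι] {Δ : FaceSet ι}
    (hΔ : IsSimplicialComplex Δ) {F : Finset ι} (hF : F ∈ facets Δ) :
    RingHom.ker (restrictVars K F) ∈ (srIdeal K Δ).minimalPrimes := by
  refine ⟨⟨RingHom.ker_isPrime _, ?_⟩, ?_⟩
  · refine Ideal.span_le.2 ?_
    rintro _ ⟨τ, hτ, rfl⟩
    obtain ⟨i, hi, hiF⟩ := exists_mem_not_mem_of_not_mem hΔ hF.1 hτ
    refine RingHom.mem_ker.2 ?_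
    rw [map_prod]
    exact Finset.prod_eq_zero hi (by simp [restrictVars, hiF])
  · rintro Q ⟨hQ, hIQ⟩ hle
    refine ker_restrictVars_le F fun i hi => ?_
    refine (hQ.mem_or_mem (hIQ (X_mul_prod_X_mem_srIdeal hF hi))).resolve_right fun h => ?_
    have h0 := RingHom.mem_ker.1 (hle h)
    rw [map_prod] at h0
    obtain ⟨j, hj, hj0⟩ := Finset.prod_eq_zero_iff.1 h0
    simp [restrictVars, hj] at hj0

theorem X_pow_dvd_scaleVars [DecidableEq ι] {Δ : FaceSet ι} (hΔ : IsSimplicialComplex Δ)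
    {F : Finset ι} (hF : F ∈ Δ) {n : ℕ} {f : MvPolynomial ι K} (hf : f ∈ srIdeal K Δ ^ n) :
    Polynomial.X ^ n ∣ scaleVars K F f := by
  have h1 : (srIdeal K Δ).map (scaleVars K F) ≤ Ideal.span {Polynomial.X} := by
    refine Ideal.map_le_iff_le_comap.2 (Ideal.span_le.2 ?_)
    rintro _ ⟨τ, hτ, rfl⟩
    obtain ⟨i, hi, hiF⟩ := exists_mem_not_mem_of_not_mem hΔ hF hτ
    refine Ideal.mem_comap.2 (Ideal.mem_span_singleton.2 ?_)
    rw [map_prod]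
    refine Dvd.dvd.trans ?_ (Finset.dvd_prod_of_mem _ hi)
    simp [scaleVars, hiF]
  have h2 := Ideal.pow_right_mono h1 n
  rw [← Ideal.map_pow, Ideal.span_singleton_pow] at h2
  exact Ideal.mem_span_singleton.1 (h2 (Ideal.mem_map_of_mem _ hf))

theorem scaleVars_prod_X_pow [Fintype ι] [DecidableEq ι] (F : Finset ι) (α : ι → ℕ) :
    scaleVars K F (∏ i, X i ^ α i) =
      Polynomial.C (∏ i, X i ^ α i) * Polynomial.X ^ ∑ i ∈ Fᶜ, α i := by
  have h (i : ι) : scaleVars K F (X i ^ α i) =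
      Polynomial.C (X i ^ α i) * if i ∈ F then 1 else Polynomial.X ^ α i := by
    by_cases hi : i ∈ F <;> simp [scaleVars, hi, mul_pow]
  rw [map_prod, Finset.prod_congr rfl fun i _ => h i, Finset.prod_mul_distrib, map_prod,
    ← Finset.prod_pow_eq_pow_sum, ← Finset.prod_mul_prod_compl F fun i => if i ∈ F then _ else _]
  congr 1
  rw [Finset.prod_congr (g := fun _ => 1) rfl fun i hi => if_pos hi, Finset.prod_const_one, one_mul]
  exact Finset.prod_congr rfl fun i hi => if_neg (Finset.mem_compl.1 hi)

/-- A facet `F` of `Δ` outside the degree complex of `I_Δ^{(n)}` at `α` satisfies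
`n ≤ ∑_{i ∉ F} α_i`. -/
theorem le_sum_compl_of_not_mem_degreeComplex [Fintype ι] [LinearOrder ι] {Δ : FaceSet ι}
    (hΔ : IsSimplicialComplex Δ) {F : Finset ι} (hF : F ∈ facets Δ) {n : ℕ} {α : ι → ℕ}
    (h : F ∉ degreeComplex K (symbolicPower (srIdeal K Δ) n) (fun i => (α i : ℤ))) :
    n ≤ ∑ i ∈ Fᶜ, α i := by
  rw [mem_degreeComplex_natCast] at h
  push Not at h
  obtain ⟨m, hm⟩ := h
  have hP := ker_restrictVars_mem_minimalPrimes (K := K) hΔ hF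
  have hmem := (Submodule.mem_iInf _).1 ((Submodule.mem_iInf _).1 hm _) hP
  have : (RingHom.ker (restrictVars K F)).IsPrime := hP.1.1
  obtain ⟨u, hu⟩ := (IsLocalization.algebraMap_mem_map_algebraMap_iff
    (RingHom.ker (restrictVars K F)).primeCompl _ _ _).1 hmem
  obtain ⟨hu, huI⟩ := hu
  have hdvd := X_pow_dvd_scaleVars hΔ hF.1 huI
  by_contra! hlt
  rw [map_mul, map_mul, scaleVars_prod_X_pow] at hdvd
  have hdvd' : Polynomial.X ^ (∑ i ∈ Fᶜ, α i) * Polynomial.X ∣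
      Polynomial.X ^ (∑ i ∈ Fᶜ, α i) * (scaleVars K F u * Polynomial.C (∏ i, X i ^ α i) *
        scaleVars K F ((∏ i ∈ F, X i) ^ m)) := by
    rw [← pow_succ]
    refine (pow_dvd_pow _ hlt).trans (hdvd.trans (dvd_of_eq ?_))
    ring
  have h0 := Polynomial.X_dvd_iff.1 ((mul_dvd_mul_iff_left (by simp)).1 hdvd')
  simp only [Polynomial.mul_coeff_zero, coeff_zero_scaleVars, Polynomial.coeff_C_zero,
    mul_eq_zero] at h0
  rcases h0 with (h0 | h0) | h0
  · exact hu h0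
  · simp [Finset.prod_eq_zero_iff] at h0
  · rw [map_pow, map_prod] at h0
    obtain ⟨j, hj, hj0⟩ := Finset.prod_eq_zero_iff.1 (eq_zero_of_pow_eq_zero h0)
    simp [restrictVars, hj] at hj0

end StanleyReisner

theorem exists_facet_superset {ι : Type*} [Finite ι] {Δ : FaceSet ι} {σ : Finset ι} (hσ : σ ∈ Δ) :
    ∃ τ ∈ facets Δ, σ ⊆ τ := by
  obtain ⟨τ, hle, hτ⟩ := (Set.toFinite Δ).exists_le_maximal hσ
  exact ⟨τ, ⟨hτ.prop, fun ρ hρ h => hτ.eq_of_le hρ h⟩, hle⟩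

section Cone

variable {K : Type*} [Field K] {ι : Type*} [LinearOrder ι]

theorem bdry_single (σ : Finset ι) :
    bdry K (Finsupp.single σ 1) =
      ∑ v ∈ σ, (-1 : K) ^ (σ.filter (· < v)).card • Finsupp.single (σ.erase v) (1 : K) := by
  simp [bdry]

/-- The cone operator with apex `v`, inserting `v` into the simplices not containing it. -/
noncomputable def coneOp (K : Type*) [Field K] {ι : Type*} [LinearOrder ι] (v : ι) :
    (Finset ι →₀ K) →ₗ[K] (Finset ι →₀ K) :=
  Finsupp.lsum K fun σ => LinearMap.toSpanSingleton K _
    (if v ∈ σ then 0 else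
      (-1 : K) ^ (σ.filter (· < v)).card • Finsupp.single (insert v σ) (1 : K))

theorem coneOp_single (v : ι) (σ : Finset ι) :
    coneOp K v (Finsupp.single σ 1) = if v ∈ σ then 0 else
      (-1 : K) ^ (σ.filter (· < v)).card • Finsupp.single (insert v σ) (1 : K) := by
  simp [coneOp]

theorem bdry_coneOp_add_coneOp_bdry_single (v : ι) (σ : Finset ι) :
    bdry K (coneOp K v (Finsupp.single σ 1)) + coneOp K v (bdry K (Finsupp.single σ 1)) =
      Finsupp.single σ (1 : K) := by
  rw [bdry_single, map_sum]
  simp only [map_smul, coneOp_single]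
  by_cases hv : v ∈ σ
  · rw [if_pos hv, map_zero, zero_add, Finset.sum_eq_single_of_mem v hv]
    · have : (σ.erase v).filter (· < v) = σ.filter (· < v) := by
        ext w; simp only [Finset.mem_filter, Finset.mem_erase]; grind
      rw [if_neg (Finset.notMem_erase v σ), Finset.insert_erase hv, this, smul_smul, ← mul_pow]
      simp
    · intro u _ huv
      rw [if_pos (Finset.mem_erase.2 ⟨huv.symm, hv⟩), smul_zero]
  · have h0 : (insert v σ).filter (· < v) = σ.filter (· < v) := by
      ext w; simp only [Finset.mem_filter, Finset.mem_insert]; grind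
    rw [if_neg hv, map_smul, bdry_single, Finset.sum_insert hv, smul_add, smul_smul, h0,
      ← mul_pow, Finset.erase_insert hv, add_assoc, Finset.smul_sum, ← Finset.sum_add_distrib,
      Finset.sum_eq_zero]
    · simp
    intro u hu
    have huv : u ≠ v := fun h => hv (h ▸ hu)
    rw [if_neg fun h => hv (Finset.mem_of_mem_erase h), Finset.erase_insert_of_ne huv.symm,
      smul_smul, smul_smul, ← add_smul]
    convert zero_smul K _
    rcases lt_or_gt_of_ne huv with h | h
    · have h1 : (insert v σ).filter (· < u) = σ.filter (· < u) := by
        ext w; simp only [Finset.mem_filter, Finset.mem_insert]; grind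
      have h2 : σ.filter (· < v) = insert u ((σ.erase u).filter (· < v)) := by
        ext w; simp only [Finset.mem_filter, Finset.mem_insert, Finset.mem_erase]; grind
      rw [h1, h2, Finset.card_insert_of_notMem (by simp)]
      ring
    · have h1 : (insert v σ).filter (· < u) = insert v (σ.filter (· < u)) := by
        ext w; simp only [Finset.mem_filter, Finset.mem_insert]; grind
      have h2 : (σ.erase u).filter (· < v) = σ.filter (· < v) := by
        ext w; simp only [Finset.mem_filter, Finset.mem_erase]; grind
      rw [h1, h2, Finset.card_insert_of_notMem (by simp [hv])]
      ring

theorem bdry_coneOp_add_coneOp_bdry (v : ι) (z : Finset ι →₀ K) :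
    bdry K (coneOp K v z) + coneOp K v (bdry K z) = z := by
  have h : bdry K ∘ₗ coneOp K v + coneOp K v ∘ₗ bdry K = LinearMap.id := by
    ext σ : 2
    exact bdry_coneOp_add_coneOp_bdry_single v σ
  exact DFunLike.congr_fun h z

theorem coneOp_mem_cardFaces {Δ : FaceSet ι} {v : ι} (hv : ∀ σ ∈ Δ, insert v σ ∈ Δ) {d : ℕ}
    {z : Finset ι →₀ K} (hz : z ∈ cardFaces K Δ d) : coneOp K v z ∈ cardFaces K Δ (d + 1) := by
  suffices h : cardFaces K Δ d ≤ (cardFaces K Δ (d + 1)).comap (coneOp K v) from h hz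
  refine Submodule.span_le.2 ?_
  rintro _ ⟨σ, hσ, rfl, rfl⟩
  rw [SetLike.mem_coe, Submodule.mem_comap, coneOp_single]
  split_ifs with h
  · exact Submodule.zero_mem _
  · exact Submodule.smul_mem _ _
      (Submodule.subset_span ⟨_, hv σ hσ, Finset.card_insert_of_notMem h, rfl⟩)

/-- A cone has vanishing reduced homology. -/
theorem not_hasNontrivialReducedHomology_of_cone {Δ : FaceSet ι} {v : ι}
    (hv : ∀ σ ∈ Δ, insert v σ ∈ Δ) (j : ℤ) : ¬HasNontrivialReducedHomology K Δ j := by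
  rintro ⟨d, -, z, hz, hz0, hzb⟩
  refine hzb ⟨coneOp K v z, coneOp_mem_cardFaces hv hz, ?_⟩
  simpa [hz0] using bdry_coneOp_add_coneOp_bdry v z

/-- If a finite complex has non-vanishing reduced homology, every vertex avoids some facet. -/
theorem exists_facet_not_mem [Finite ι] {Δ : FaceSet ι} (hΔ : IsSimplicialComplex Δ) {j : ℤ}
    (h : HasNontrivialReducedHomology K Δ j) (v : ι) : ∃ τ ∈ facets Δ, v ∉ τ := by
  by_contra! hv
  refine not_hasNontrivialReducedHomology_of_cone (v := v) (fun σ hσ => ?_) j h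
  obtain ⟨τ, hτ, hle⟩ := exists_facet_superset hσ
  exact hΔ τ hτ.1 _ (Finset.insert_subset (hv τ hτ) hle)

end Cone

section Polyhedron

variable {r t s : ℕ} {F : Fin t → Finset (Fin r)}

theorem isBounded_polyC (m : ℝ) (h : ∀ i, ∃ j : Fin t, (j : ℕ) < s ∧ i ∉ F j) :
    Bornology.IsBounded (polyC F s m) := by
  refine (Metric.isBounded_Icc (0 : Fin r → ℝ) (fun _ => m)).subset fun x hx => ?_
  refine ⟨fun i => hx.1 i, fun i => ?_⟩
  obtain ⟨j, hj, hij⟩ := h i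
  exact (Finset.single_le_sum (fun k _ => hx.1 k) (Finset.mem_compl.2 hij)).trans ((hx.2 j).1 hj)

theorem affineSpan_polyC_eq_top {m : ℝ} {x : Fin r → ℝ} (hx : ∀ i, 0 < x i)
    (hlt : ∀ j : Fin t, (j : ℕ) < s → ∑ i ∈ (F j)ᶜ, x i < m)
    (hgt : ∀ j : Fin t, s ≤ (j : ℕ) → m < ∑ i ∈ (F j)ᶜ, x i) :
    affineSpan ℝ (polyC F s m) = ⊤ := by
  have hpos : ∀ᶠ y in nhds x, ∀ i, 0 < y i := eventually_all.2 fun i =>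
    (continuous_apply i).continuousAt.eventually_const_lt (hx i)
  have hsum (j : Fin t) : ContinuousAt (fun y : Fin r → ℝ => ∑ i ∈ (F j)ᶜ, y i) x := by
    fun_prop
  have hle : ∀ᶠ y in nhds x, ∀ j : Fin t, (j : ℕ) < s → ∑ i ∈ (F j)ᶜ, y i < m :=
    eventually_all.2 fun j => eventually_imp_distrib_left.2 fun hj =>
      (hsum j).eventually_lt_const (hlt j hj)
  have hge : ∀ᶠ y in nhds x, ∀ j : Fin t, s ≤ (j : ℕ) → m < ∑ i ∈ (F j)ᶜ, y i :=
    eventually_all.2 fun j => eventually_imp_distrib_left.2 fun hj =>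
      (hsum j).eventually_const_lt (hgt j hj)
  refine affineSpan_eq_top_of_nonempty_interior ⟨x, ?_⟩
  refine interior_mono (subset_convexHull ℝ _) (mem_interior_iff_mem_nhds.2 ?_)
  filter_upwards [hpos, hle, hge] with y h0 h1 h2
  exact ⟨fun i => (h0 i).le, fun j => ⟨fun hj => (h1 j hj).le, fun hj => (h2 j hj).le⟩⟩

theorem affineSpan_polyC_one_eq_top_of_nat {n : ℕ} (hn : 1 ≤ n) {α : Fin r → ℕ}
    (hlt : ∀ j : Fin t, (j : ℕ) < s → ∑ i ∈ (F j)ᶜ, α i < n)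
    (hge : ∀ j : Fin t, s ≤ (j : ℕ) → n ≤ ∑ i ∈ (F j)ᶜ, α i) :
    affineSpan ℝ (polyC F s 1) = ⊤ := by
  have hn' : (1 : ℝ) ≤ n := by exact_mod_cast hn
  have hc : (0 : ℝ) < n - 1 / 2 := by linarith
  set δ : ℝ := 1 / (2 * (r + 1)) with hδ
  have hδ0 : 0 < δ := by positivity
  have hsum (j : Fin t) : ∑ i ∈ (F j)ᶜ, ((α i : ℝ) + δ) / (n - 1 / 2) =
      (((∑ i ∈ (F j)ᶜ, α i : ℕ) : ℝ) + (F j)ᶜ.card * δ) / (n - 1 / 2) := by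
    rw [← Finset.sum_div, Finset.sum_add_distrib]
    simp
  refine affineSpan_polyC_eq_top (x := fun i => ((α i : ℝ) + δ) / (n - 1 / 2))
    (fun i => by positivity) (fun j hj => ?_) (fun j hj => ?_)
  · rw [hsum, div_lt_one hc]
    have h1 : ((∑ i ∈ (F j)ᶜ, α i : ℕ) : ℝ) + 1 ≤ n := by exact_mod_cast hlt j hj
    have h2 : ((F j)ᶜ.card : ℝ) ≤ r := by
      exact_mod_cast (Finset.card_le_univ _).trans_eq (Fintype.card_fin r)
    have h3 : (r + 1) * δ = 1 / 2 := by
      rw [hδ]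
      field_simp
    nlinarith
  · rw [hsum, one_lt_div hc]
    have h1 : (n : ℝ) ≤ ((∑ i ∈ (F j)ᶜ, α i : ℕ) : ℝ) := by exact_mod_cast hge j hj
    have h2 : 0 ≤ ((F j)ᶜ.card : ℝ) * δ := by positivity
    linarith

end Polyhedron

/-- In the situation where `Δ` has facets `F_1, …, F_t`, with
`H_𝔪^i(R/I_Δ^{(n)})_α ≠ 0` for some `n ≥ 1`, `i ≥ 0`, `α ∈ ℕ^r`, and
`F(Δ_α(I_Δ^{(n)})) = {F_1, …, F_s}`, the polyhedron `C_1` is a polytope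
(i.e. bounded) of dimension `r` (its affine span is everything). -/
theorem statement7 {K : Type*} [Field K] {r t s : ℕ}
    (Δ : FaceSet (Fin r)) (hΔ : IsSimplicialComplex Δ)
    (F : Fin t → Finset (Fin r)) (hFinj : Function.Injective F)
    (hF : facets Δ = Set.range F)
    (n : ℕ) (hn : 1 ≤ n) (i : ℕ) (α : Fin r → ℕ)
    (hlc : lcNonzero K (symbolicPower (srIdeal K Δ) n) i (fun j => (α j : ℤ)))
    (hs : 1 ≤ s) (hst : s ≤ t)
    (hfac : facets (degreeComplex K (symbolicPower (srIdeal K Δ) n) (fun j => (α j : ℤ)))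
      = F '' {j : Fin t | (j : ℕ) < s}) :
    Bornology.IsBounded (polyC F s 1) ∧ affineSpan ℝ (polyC F s 1) = ⊤ := by
  have hlt (j : Fin t) (hj : (j : ℕ) < s) :
      F j ∈ facets (degreeComplex K (symbolicPower (srIdeal K Δ) n) (fun j => (α j : ℤ))) :=
    hfac ▸ Set.mem_image_of_mem F hj
  have hfacet (j : Fin t) : F j ∈ facets Δ := hF ▸ Set.mem_range_self j
  constructor
  · refine isBounded_polyC 1 fun v => ?_
    obtain ⟨τ, hτ, hv⟩ :=
      exists_facet_not_mem (degreeComplex_natCast_isSimplicialComplex _ α) hlc v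
    rw [hfac] at hτ
    obtain ⟨j, hj, rfl⟩ := hτ
    exact ⟨j, hj, hv⟩
  · refine affineSpan_polyC_one_eq_top_of_nat hn
      (fun j hj => sum_compl_lt_of_mem_degreeComplex (hfacet j) (hlt j hj).1)
      (fun j hj => le_sum_compl_of_not_mem_degreeComplex (K := K) hΔ (hfacet j) fun h => ?_)
    have hmem : F j ∈ facets (degreeComplex K (symbolicPower (srIdeal K Δ) n)
        (fun j => (α j : ℤ))) :=
      ⟨h, fun τ hτ => (hfacet j).2 τ (degreeComplex_symbolicPower_subset Δ n α hτ)⟩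
    rw [hfac] at hmem
    obtain ⟨k, hk, hkj⟩ := hmem
    exact absurd (hFinj hkj ▸ hk : (j : ℕ) < s) (not_lt.2 hj)
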